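/- Assume n ≥ 3, 0 ≤ a < (n−2)/2, a ≤ b < a+1 and p = 2n/(n−2+2(b−a)), and let ζ be a positive nonconstant periodic solution of (Z). Then there exists an increasing sequence of positive constants {σ_i}_{i≥1}, divergent to ∞, such that for every i ≥ 1 the kernel of 𝓛_i has a basis e^{−σ_i t} q_i^+ and e^{σ_i t} q_i^−, for some smooth periodic functions q_i^+ and q_i^− on ℝ with the same period as ζ. -/

import Mathlib

open Real Set Metric Filter Function

noncomputable section

/-- The Euclidean Laplacian of `f` at `x`. -/
def lapE {n : ℕ} (f : EuclideanSpace ℝ (Fin n) → ℝ) (x : EuclideanSpace ℝ (Fin n)) : ℝ :=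
  ∑ i : Fin n, iteratedFDeriv ℝ 2 f x ![EuclideanSpace.single i 1, EuclideanSpace.single i 1]

/-- The Laplace–Beltrami operator `Δ_θ` on the unit sphere `S^{n-1}`, computed via the
degree-zero homogeneous extension: for `θ` with `‖θ‖ = 1`, `sphLap f θ = Δ_θ f (θ)`. -/
def sphLap {n : ℕ} (f : EuclideanSpace ℝ (Fin n) → ℝ) (θ : EuclideanSpace ℝ (Fin n)) : ℝ :=
  lapE (fun x => f (‖x‖⁻¹ • x)) θ

/-- Second derivative in the `t` variable. -/
def dtt (g : ℝ → ℝ) : ℝ → ℝ := deriv (deriv g)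

/-- Dimension of the space of spherical harmonics on `S^{n-1}` of degree at most `d`. -/
def cumHarm (n d : ℕ) : ℕ := Nat.choose (n - 1 + d) (n - 1) + Nat.choose (n - 2 + d) (n - 1)

/-- The degree of the `i`-th spherical harmonic, eigenfunctions being listed with multiplicity. -/
def sphDeg (n i : ℕ) : ℕ := sInf {d | i < cumHarm n d}

/-- The `i`-th eigenvalue `λ_i` of `-Δ_θ` on `S^{n-1}`, listed in increasing order and
repeated with multiplicity: `λ_i = d (n + d - 2)` where `d` is the degree of the `i`-th
spherical harmonic.  In particular `λ_0 = 0`, `λ_1 = ⋯ = λ_n = n - 1`, `λ_{n+1} = 2n`. -/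
def sphEval (n i : ℕ) : ℝ := (sphDeg n i : ℝ) * ((n : ℝ) + (sphDeg n i : ℝ) - 2)

/-- The linearized operator `L_i = -d²/dt² + λ + (n-2)²/4 - ((n+2)/(n-2)) K(0) ξ^{4/(n-2)}`. -/
def Lop (n : ℕ) (K0 : ℝ) (ξ : ℝ → ℝ) (lam : ℝ) (h : ℝ → ℝ) : ℝ → ℝ :=
  fun t => -dtt h t
    + (lam + ((n : ℝ) - 2) ^ 2 / 4
        - ((n : ℝ) + 2) / ((n : ℝ) - 2) * K0 * ξ t ^ ((4 : ℝ) / ((n : ℝ) - 2))) * h t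

/-- The linearized operator `𝓛_i = -d²/dt² + λ + (n-2a-2)²/4 - (p-1) ζ^{p-2}` for the
Caffarelli-Kohn-Nirenberg equation. -/
def LopCKN (n : ℕ) (a p : ℝ) (ζ : ℝ → ℝ) (lam : ℝ) (h : ℝ → ℝ) : ℝ → ℝ :=
  fun t => -dtt h t + (lam + ((n : ℝ) - 2 * a - 2) ^ 2 / 4 - (p - 1) * ζ t ^ (p - 2)) * h t

/-- `f, g` is a basis of the kernel of the second-order ODE operator `L` acting on `C²(ℝ)`. -/
def KerBasis (L : (ℝ → ℝ) → ℝ → ℝ) (f g : ℝ → ℝ) : Prop :=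
  ContDiff ℝ 2 f ∧ ContDiff ℝ 2 g ∧ (∀ t, L f t = 0) ∧ (∀ t, L g t = 0) ∧
    LinearIndependent ℝ ![f, g] ∧
    ∀ h : ℝ → ℝ, ContDiff ℝ 2 h → (∀ t, L h t = 0) →
      ∃ c₁ c₂ : ℝ, ∀ t, h t = c₁ * f t + c₂ * g t

/-- `ξ` is a positive `T`-periodic solution of the Fowler equation
`-ξ'' + ((n-2)²/4) ξ = K(0) ξ^{(n+2)/(n-2)}` on `ℝ`. -/
def FowlerXi (n : ℕ) (K0 : ℝ) (ξ : ℝ → ℝ) (T : ℝ) : Prop :=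
  ContDiff ℝ 2 ξ ∧ (∀ t, 0 < ξ t) ∧ 0 < T ∧ Function.Periodic ξ T ∧
    ∀ t, -dtt ξ t + ((n : ℝ) - 2) ^ 2 / 4 * ξ t = K0 * ξ t ^ (((n : ℝ) + 2) / ((n : ℝ) - 2))

/-- `ζ` is a positive `T`-periodic solution of `-ζ'' + ((n-2a-2)²/4) ζ = ζ^{p-1}` on `ℝ`. -/
def ZetaSol (n : ℕ) (a p : ℝ) (ζ : ℝ → ℝ) (T : ℝ) : Prop :=
  ContDiff ℝ 2 ζ ∧ (∀ t, 0 < ζ t) ∧ 0 < T ∧ Function.Periodic ζ T ∧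
    ∀ t, -dtt ζ t + ((n : ℝ) - 2 * a - 2) ^ 2 / 4 * ζ t = ζ t ^ (p - 1)

/-- `ρ` is the increasing, divergent sequence of positive exponents such that, for every
`i ≥ 1`, the kernel of the linearized operator `L_i` at the Fowler solution `ξ` has a basis
`e^{-ρ_i t} p_i⁺(t)`, `e^{ρ_i t} p_i⁻(t)` with `p_i^±` smooth and `T`-periodic. -/
def FowlerExponents (n : ℕ) (K0 : ℝ) (ξ : ℝ → ℝ) (T : ℝ) (ρ : ℕ → ℝ) : Prop :=
  (∀ i, 1 ≤ i → 0 < ρ i) ∧ (∀ i j, 1 ≤ i → i ≤ j → ρ i ≤ ρ j) ∧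
    Tendsto ρ atTop atTop ∧
    ∀ i, 1 ≤ i → ∃ p₁ p₂ : ℝ → ℝ, ContDiff ℝ (⊤ : ℕ∞) p₁ ∧ ContDiff ℝ (⊤ : ℕ∞) p₂ ∧
      Function.Periodic p₁ T ∧ Function.Periodic p₂ T ∧
      KerBasis (Lop n K0 ξ (sphEval n i))
        (fun t => Real.exp (-(ρ i) * t) * p₁ t) (fun t => Real.exp (ρ i * t) * p₂ t)

/-- Analogue of `FowlerExponents` for the CKN linearized operators `𝓛_i`. -/
def CKNExponents (n : ℕ) (a p : ℝ) (ζ : ℝ → ℝ) (T : ℝ) (σ : ℕ → ℝ) : Prop :=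
  (∀ i, 1 ≤ i → 0 < σ i) ∧ (∀ i j, 1 ≤ i → i ≤ j → σ i ≤ σ j) ∧
    Tendsto σ atTop atTop ∧
    ∀ i, 1 ≤ i → ∃ q₁ q₂ : ℝ → ℝ, ContDiff ℝ (⊤ : ℕ∞) q₁ ∧ ContDiff ℝ (⊤ : ℕ∞) q₂ ∧
      Function.Periodic q₁ T ∧ Function.Periodic q₂ T ∧
      KerBasis (LopCKN n a p ζ (sphEval n i))
        (fun t => Real.exp (-(σ i) * t) * q₁ t) (fun t => Real.exp (σ i * t) * q₂ t)

/-- The index set `{ Σ_{i≥1} nᵢ ρᵢ > 0 : nᵢ ∈ ℕ, finitely many nᵢ > 0 }`. -/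
def IndexSet (ρ : ℕ → ℝ) : Set ℝ :=
  {s | 0 < s ∧ ∃ f : ℕ →₀ ℕ, (∀ i ∈ f.support, 1 ≤ i) ∧
    s = ∑ i ∈ f.support, (f i : ℝ) * ρ i}

/-- `v` is a positive solution on `(t₀, ∞) × S^{n-1}` of the cylindrical conformal scalar
curvature equation `-v_tt - Δ_θ v + ((n-2)²/4) v = K(e^{-t}θ) v^{(n+2)/(n-2)}`. -/
def SolCyl (n : ℕ) (K : EuclideanSpace ℝ (Fin n) → ℝ)
    (v : ℝ → EuclideanSpace ℝ (Fin n) → ℝ) (t₀ : ℝ) : Prop :=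
  (∀ t θ, t₀ < t → ‖θ‖ = 1 → 0 < v t θ) ∧
    ∀ (t : ℝ) (θ : EuclideanSpace ℝ (Fin n)), t₀ < t → ‖θ‖ = 1 →
      -dtt (fun s => v s θ) t - sphLap (v t) θ + ((n : ℝ) - 2) ^ 2 / 4 * v t θ
        = K (Real.exp (-t) • θ) * v t θ ^ (((n : ℝ) + 2) / ((n : ℝ) - 2))

/-- `w` is a positive solution on `(t₀, ∞) × S^{n-1}` of the cylindrical CKN equation
`-w_tt - Δ_θ w + ((n-2a-2)²/4) w = w^{p-1}`. -/
def SolCylW (n : ℕ) (a p : ℝ) (w : ℝ → EuclideanSpace ℝ (Fin n) → ℝ) (t₀ : ℝ) : Prop :=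
  (∀ t θ, t₀ < t → ‖θ‖ = 1 → 0 < w t θ) ∧
    ∀ (t : ℝ) (θ : EuclideanSpace ℝ (Fin n)), t₀ < t → ‖θ‖ = 1 →
      -dtt (fun s => w s θ) t - sphLap (w t) θ + ((n : ℝ) - 2 * a - 2) ^ 2 / 4 * w t θ
        = w t θ ^ (p - 1)

/-- `v(t, θ) → ξ(t)` as `t → ∞`, uniformly for `θ ∈ S^{n-1}`. -/
def UnifConv {n : ℕ} (v : ℝ → EuclideanSpace ℝ (Fin n) → ℝ) (ξ : ℝ → ℝ) : Prop :=
  ∀ ε > 0, ∃ T : ℝ, ∀ t ≥ T, ∀ θ : EuclideanSpace ℝ (Fin n), ‖θ‖ = 1 → |v t θ - ξ t| < ε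

/-- The degree-zero homogeneous (in the sphere variable) representative of a function on the
cylinder `ℝ × S^{n-1}`. -/
def cylRep {n : ℕ} (F : ℝ → EuclideanSpace ℝ (Fin n) → ℝ) :
    ℝ × EuclideanSpace ℝ (Fin n) → ℝ :=
  fun pt => F pt.1 (‖pt.2‖⁻¹ • pt.2)

/-- The norm of the intrinsic gradient on the cylinder `ℝ × S^{n-1}` at `(t, θ)`. -/
def cylGrad {n : ℕ} (F : ℝ → EuclideanSpace ℝ (Fin n) → ℝ) (t : ℝ)
    (θ : EuclideanSpace ℝ (Fin n)) : ℝ :=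
  ‖fderiv ℝ (cylRep F) (t, θ)‖

/-- Membership in `C^{2,α}` of a region `s` of the cylinder. -/
def CylC2Holder {n : ℕ} (α : ℝ) (s : Set (ℝ × EuclideanSpace ℝ (Fin n)))
    (F : ℝ → EuclideanSpace ℝ (Fin n) → ℝ) : Prop :=
  ContDiffOn ℝ 2 (cylRep F) s ∧
    ∃ C : ℝ, ∀ p ∈ s, ∀ q ∈ s,
      ‖iteratedFDerivWithin ℝ 2 (cylRep F) s p - iteratedFDerivWithin ℝ 2 (cylRep F) s q‖
        ≤ C * ‖p - q‖ ^ α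

/-- A bounded smooth function on `(t₀, ∞) × S^{n-1}`. -/
def BddSmoothCyl {n : ℕ} (t₀ : ℝ) (c : ℝ → EuclideanSpace ℝ (Fin n) → ℝ) : Prop :=
  ContDiffOn ℝ (⊤ : ℕ∞) (cylRep c)
      ((Ioi t₀) ×ˢ {x : EuclideanSpace ℝ (Fin n) | x ≠ 0}) ∧
    ∃ M : ℝ, ∀ t θ, t₀ < t → ‖θ‖ = 1 → |c t θ| ≤ M

/-- The nonlinear operator `𝓜(f) = -f_tt - Δ_θ f + ((n-2)²/4) f - K f^{(n+2)/(n-2)}`. -/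
def Mop (n : ℕ) (K : EuclideanSpace ℝ (Fin n) → ℝ)
    (f : ℝ → EuclideanSpace ℝ (Fin n) → ℝ) (t : ℝ) (θ : EuclideanSpace ℝ (Fin n)) : ℝ :=
  -dtt (fun s => f s θ) t - sphLap (f t) θ + ((n : ℝ) - 2) ^ 2 / 4 * f t θ
    - K (Real.exp (-t) • θ) * f t θ ^ (((n : ℝ) + 2) / ((n : ℝ) - 2))

/-- The nonlinear operator `𝓝(f) = -f_tt - Δ_θ f + ((n-2a-2)²/4) f - f^{p-1}`. -/
def Nop (n : ℕ) (a p : ℝ)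
    (f : ℝ → EuclideanSpace ℝ (Fin n) → ℝ) (t : ℝ) (θ : EuclideanSpace ℝ (Fin n)) : ℝ :=
  -dtt (fun s => f s θ) t - sphLap (f t) θ + ((n : ℝ) - 2 * a - 2) ^ 2 / 4 * f t θ
    - f t θ ^ (p - 1)


/-- Bound for the integral against the exponential weight, on the positive half line. -/
lemma aux_int_bound_pos {E : Type*} [NormedAddCommGroup E] [NormedSpace ℝ E]
    {K C : ℝ} (hK : 0 < K) (hC : 0 ≤ C) (f : ℝ → E)
    (hb : ∀ s, ‖f s‖ ≤ C * (K * exp (2 * K * |s|))) (t : ℝ) (ht : 0 ≤ t) :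
    ‖∫ s in (0:ℝ)..t, f s‖ ≤ C / 2 * exp (2 * K * |t|) := by
  have h1 : ‖∫ s in (0:ℝ)..t, f s‖ ≤ ∫ s in (0:ℝ)..t, C * (K * exp (2 * K * s)) := by
    apply intervalIntegral.norm_integral_le_of_norm_le ht
    · refine Eventually.of_forall fun s hs => ?_
      have := hb s
      rwa [abs_of_pos hs.1] at this
    · exact (by fun_prop : Continuous fun s => C * (K * exp (2 * K * s))).intervalIntegrable _ _
  have h2 : ∫ s in (0:ℝ)..t, C * (K * exp (2 * K * s)) = C / 2 * exp (2 * K * t) - C / 2 := by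
    have hd : ∀ s ∈ uIcc 0 t, HasDerivAt (fun s => C / 2 * exp (2 * K * s))
        (C * (K * exp (2 * K * s))) s := by
      intro s _
      have := (((hasDerivAt_id s).const_mul (2 * K)).exp).const_mul (C / 2)
      refine this.congr_deriv ?_
      simp only [id]; ring
    rw [intervalIntegral.integral_eq_sub_of_hasDerivAt hd]
    · simp
    · exact (by fun_prop : Continuous fun s => C * (K * exp (2 * K * s))).intervalIntegrable _ _
  rw [abs_of_nonneg ht]
  linarith

lemma aux_int_bound {E : Type*} [NormedAddCommGroup E] [NormedSpace ℝ E]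
    {K C : ℝ} (hK : 0 < K) (hC : 0 ≤ C) (f : ℝ → E)
    (hb : ∀ s, ‖f s‖ ≤ C * (K * exp (2 * K * |s|))) (t : ℝ) :
    ‖∫ s in (0:ℝ)..t, f s‖ ≤ C / 2 * exp (2 * K * |t|) := by
  rcases le_total 0 t with ht | ht
  · exact aux_int_bound_pos hK hC f hb t ht
  · have := aux_int_bound_pos hK hC (fun s => f (-s)) (fun s => by simpa using hb (-s)) (-t)
      (by linarith)
    rw [intervalIntegral.integral_comp_neg, abs_neg, neg_zero, neg_neg,
      intervalIntegral.integral_symm, norm_neg] at this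
    exact this

/-- Global existence for linear ODEs with bounded continuous coefficients. -/
lemma lin_ode {E : Type*} [NormedAddCommGroup E] [NormedSpace ℝ E] [CompleteSpace E]
    (A : ℝ → E →L[ℝ] E) (hA : Continuous A) {K : ℝ} (hK : 0 < K) (hb : ∀ t, ‖A t‖ ≤ K) (x : E) :
    ∃ u : ℝ → E, u 0 = x ∧ ∀ t, HasDerivAt u (A t (u t)) t := by
  let w : ℝ → ℝ := fun t => exp (2 * K * |t|)
  have hw : Continuous w := by fun_prop
  have hwpos : ∀ t, 0 < w t := fun t => exp_pos _
  have hw1 : ∀ t, 1 ≤ w t := fun t => one_le_exp (by positivity)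
  have hcont : ∀ g : BoundedContinuousFunction ℝ E, Continuous fun s => A s (w s • g s) := by
    intro g
    exact hA.clm_apply (hw.smul g.continuous)
  let I : BoundedContinuousFunction ℝ E → ℝ → E := fun g t => ∫ s in (0:ℝ)..t, A s (w s • g s)
  have hIc : ∀ g, Continuous (I g) := fun g => by
    exact intervalIntegral.continuous_primitive
      (fun a b => (hcont g).intervalIntegrable a b) 0
  have hIb : ∀ g t, ‖I g t‖ ≤ ‖g‖ / 2 * w t := by
    intro g t
    refine aux_int_bound hK (norm_nonneg g) _ (fun s => ?_) t
    calc ‖A s (w s • g s)‖ ≤ ‖A s‖ * ‖w s • g s‖ := (A s).le_opNorm _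
      _ ≤ K * (w s * ‖g‖) := by
        rw [norm_smul, Real.norm_of_nonneg (hwpos s).le]
        gcongr
        · exact hb s
        · exact g.norm_coe_le_norm s
      _ = ‖g‖ * (K * exp (2 * K * |s|)) := by simp only [w]; ring
  let Φ : BoundedContinuousFunction ℝ E → BoundedContinuousFunction ℝ E := fun g =>
    BoundedContinuousFunction.ofNormedAddCommGroup (fun t => (w t)⁻¹ • (x + I g t))
      ((hw.inv₀ (fun t => (hwpos t).ne')).smul (continuous_const.add (hIc g)))
      (‖x‖ + ‖g‖ / 2) (by
        intro t
        rw [norm_smul, norm_inv, Real.norm_of_nonneg (hwpos t).le, inv_mul_le_iff₀ (hwpos t)]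
        calc ‖x + I g t‖ ≤ ‖x‖ + ‖I g t‖ := norm_add_le _ _
          _ ≤ w t * ‖x‖ + ‖g‖ / 2 * w t := by
            gcongr
            · exact le_mul_of_one_le_left (norm_nonneg _) (hw1 t)
            · exact hIb g t
          _ = w t * (‖x‖ + ‖g‖ / 2) := by ring)
  have hΦ : ∀ g t, Φ g t = (w t)⁻¹ • (x + I g t) := fun g t => rfl
  have hsub : ∀ g g' t, I g t - I g' t = I (g - g') t := by
    intro g g' t
    simp only [I]
    rw [← intervalIntegral.integral_sub ((hcont g).intervalIntegrable _ _)
      ((hcont g').intervalIntegrable _ _)]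
    congr 1; ext s; simp [smul_sub]
  have hc : ContractingWith (1/2) Φ := by
    refine ⟨by norm_num, LipschitzWith.of_dist_le_mul fun g g' => ?_⟩
    rw [BoundedContinuousFunction.dist_le (by positivity)]
    intro t
    rw [dist_eq_norm, hΦ, hΦ, ← smul_sub, add_sub_add_left_eq_sub, hsub, norm_smul, norm_inv,
      Real.norm_of_nonneg (hwpos t).le, inv_mul_le_iff₀ (hwpos t), dist_eq_norm]
    refine (hIb _ t).trans (le_of_eq ?_)
    simp; ring
  obtain ⟨g, hg⟩ : ∃ g, Φ g = g := ⟨hc.fixedPoint, hc.fixedPoint_isFixedPt⟩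
  have hu : ∀ t, w t • g t = x + I g t := by
    intro t
    have : g t = (w t)⁻¹ • (x + I g t) := by rw [← hΦ, hg]
    rw [this, smul_inv_smul₀ (hwpos t).ne']
  refine ⟨fun t => w t • g t, by simp only [hu]; simp [I], fun t => ?_⟩
  have h1 : HasDerivAt (fun t => x + I g t) (A t (w t • g t)) t := by
    have := intervalIntegral.integral_hasDerivAt_right ((hcont g).intervalIntegrable 0 t)
      ((hcont g).stronglyMeasurableAtFilter _ _) (hcont g).continuousAt
    exact this.const_add x
  exact h1.congr_of_eventuallyEq (Eventually.of_forall hu)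

/-- First order system `y' = α z`, `z' = β y`. -/
def Sys (α β y z : ℝ → ℝ) : Prop :=
  (∀ t, HasDerivAt y (α t * z t) t) ∧ ∀ t, HasDerivAt z (β t * y t) t

lemma exists_sys (α β : ℝ → ℝ) (hα : Continuous α) (hβ : Continuous β) {K : ℝ}
    (hαK : ∀ t, |α t| ≤ K) (hβK : ∀ t, |β t| ≤ K) (y0 z0 : ℝ) :
    ∃ y z, Sys α β y z ∧ y 0 = y0 ∧ z 0 = z0 := by
  let A : ℝ → (ℝ × ℝ) →L[ℝ] (ℝ × ℝ) := fun t =>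
    (α t) • ((ContinuousLinearMap.snd ℝ ℝ ℝ).prod 0) +
      (β t) • ((0 : (ℝ × ℝ) →L[ℝ] ℝ).prod (ContinuousLinearMap.fst ℝ ℝ ℝ))
  have hA : Continuous A := by fun_prop
  set P := ((ContinuousLinearMap.snd ℝ ℝ ℝ).prod (0 : (ℝ × ℝ) →L[ℝ] ℝ)) with hP
  set P' := ((0 : (ℝ × ℝ) →L[ℝ] ℝ).prod (ContinuousLinearMap.fst ℝ ℝ ℝ)) with hP'
  have hK : 0 ≤ K := (abs_nonneg _).trans (hαK 0)
  obtain ⟨u, hu0, hu⟩ := lin_ode A hA (K := K * ‖P‖ + K * ‖P'‖ + 1) (by positivity) (fun t => by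
    calc ‖A t‖ ≤ ‖α t • P‖ + ‖β t • P'‖ := norm_add_le _ _
      _ ≤ K * ‖P‖ + K * ‖P'‖ := by
        rw [norm_smul, norm_smul]
        gcongr
        · exact hαK t
        · exact hβK t
      _ ≤ _ := by linarith) (y0, z0)
  refine ⟨fun t => (u t).1, fun t => (u t).2, ⟨fun t => ?_, fun t => ?_⟩, by simp [hu0],
    by simp [hu0]⟩
  · have := (ContinuousLinearMap.fst ℝ ℝ ℝ).hasFDerivAt.comp_hasDerivAt t (hu t)
    simpa [A, Function.comp_def] using this
  · have := (ContinuousLinearMap.snd ℝ ℝ ℝ).hasFDerivAt.comp_hasDerivAt t (hu t)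
    simpa [A, Function.comp_def] using this

lemma hasDerivAt_negsq (x : ℝ) : HasDerivAt (fun x : ℝ => (min x 0) ^ 2) (2 * min x 0) x := by
  rcases lt_trichotomy x 0 with h | h | h
  · have h1 : HasDerivAt (fun x : ℝ => x ^ 2) (2 * x) x := by simpa using hasDerivAt_pow 2 x
    rw [min_eq_left h.le]
    refine h1.congr_of_eventuallyEq ?_
    filter_upwards [Iio_mem_nhds h] with y hy
    rw [min_eq_left (le_of_lt hy)]
  · subst h
    rw [hasDerivAt_iff_isLittleO_nhds_zero]
    have h2 : (fun h : ℝ => h ^ 2) =o[nhds 0] fun h : ℝ => h := by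
      simpa using Asymptotics.isLittleO_pow_id (𝕜 := ℝ) (n := 2) (by norm_num)
    refine Asymptotics.IsBigO.trans_isLittleO (Asymptotics.IsBigO.of_norm_le fun h => ?_) h2
    simp only [zero_add, min_self, mul_zero, smul_zero, sub_zero]
    rw [show ((0:ℝ)^2) = 0 by norm_num, sub_zero, norm_pow]
    rcases le_total h 0 with hh | hh
    · rw [min_eq_left hh]; simp
    · rw [min_eq_right hh]; simp; positivity
  · rw [min_eq_right h.le]
    refine (hasDerivAt_const x (0:ℝ)).congr_of_eventuallyEq ?_ |>.congr_deriv (by simp)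
    filter_upwards [Ioi_mem_nhds h] with y hy
    rw [min_eq_right (le_of_lt hy)]; simp

/-- Positivity for cooperative systems. -/
lemma pos_lemma {α β g y z : ℝ → ℝ} {K : ℝ} (hα0 : ∀ t, 0 ≤ α t) (hβ0 : ∀ t, 0 ≤ β t)
    (hαK : ∀ t, |α t| ≤ K) (hβK : ∀ t, |β t| ≤ K) (hg : ∀ t, 0 ≤ t → 0 ≤ g t)
    (hy : ∀ t, HasDerivAt y (α t * z t) t) (hz : ∀ t, HasDerivAt z (β t * y t + g t) t)
    (hy0 : 0 ≤ y 0) (hz0 : 0 ≤ z 0) (t : ℝ) (ht : 0 ≤ t) : 0 ≤ y t ∧ 0 ≤ z t := by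
  let N : ℝ → ℝ := fun t => exp (-(2 * K) * t) * ((min (y t) 0) ^ 2 + (min (z t) 0) ^ 2)
  have hN : ∀ t, HasDerivAt N (exp (-(2 * K) * t) * (-(2 * K)) *
      ((min (y t) 0) ^ 2 + (min (z t) 0) ^ 2) + exp (-(2 * K) * t) *
      (2 * min (y t) 0 * (α t * z t) + 2 * min (z t) 0 * (β t * y t + g t))) t := by
    intro t
    have h1 := (hasDerivAt_negsq (y t)).comp t (hy t)
    have h2 := (hasDerivAt_negsq (z t)).comp t (hz t)
    have h3 : HasDerivAt (fun t => exp (-(2 * K) * t)) (exp (-(2 * K) * t) * (-(2 * K))) t := by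
      simpa using ((hasDerivAt_id t).const_mul (-(2 * K))).exp
    exact h3.mul (h1.add h2)
  have hanti : AntitoneOn N (Ici 0) := by
    refine antitoneOn_of_deriv_nonpos (convex_Ici 0)
      (fun t _ => (hN t).continuousAt.continuousWithinAt)
      (fun t _ => (hN t).differentiableAt.differentiableWithinAt) ?_
    intro t ht
    rw [interior_Ici] at ht
    rw [(hN t).deriv]
    set Y := min (y t) 0
    set Z := min (z t) 0
    have hY : Y ≤ 0 := min_le_right _ _
    have hZ : Z ≤ 0 := min_le_right _ _
    have hYy : Y ≤ y t := min_le_left _ _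
    have hZz : Z ≤ z t := min_le_left _ _
    have e1 : Y * (α t * z t) ≤ α t * (Y * Z) := by
      have : α t * (Y * z t) ≤ α t * (Y * Z) :=
        mul_le_mul_of_nonneg_left (mul_le_mul_of_nonpos_left hZz hY) (hα0 t)
      linarith [this]
    have e2 : Z * (β t * y t) ≤ β t * (Y * Z) := by
      have : β t * (Z * y t) ≤ β t * (Z * Y) :=
        mul_le_mul_of_nonneg_left (mul_le_mul_of_nonpos_left hYy hZ) (hβ0 t)
      linarith [this]
    have e3 : Z * g t ≤ 0 := mul_nonpos_of_nonpos_of_nonneg hZ (hg t (le_of_lt ht))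
    have e4 : α t * (Y * Z) ≤ K * (Y * Z) :=
      mul_le_mul_of_nonneg_right ((le_abs_self _).trans (hαK t)) (mul_nonneg_of_nonpos_of_nonpos hY hZ)
    have e5 : β t * (Y * Z) ≤ K * (Y * Z) :=
      mul_le_mul_of_nonneg_right ((le_abs_self _).trans (hβK t)) (mul_nonneg_of_nonpos_of_nonpos hY hZ)
    have hK : 0 ≤ K := (abs_nonneg _).trans (hαK 0)
    have e6 : K * (2 * (Y * Z)) ≤ K * (Y ^ 2 + Z ^ 2) :=
      mul_le_mul_of_nonneg_left (by nlinarith [sq_nonneg (Y - Z)]) hK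
    have : exp (-(2 * K) * t) * (-(2 * K)) * (Y ^ 2 + Z ^ 2) + exp (-(2 * K) * t) *
      (2 * Y * (α t * z t) + 2 * Z * (β t * y t + g t)) = exp (-(2 * K) * t) *
      (-(2 * K) * (Y ^ 2 + Z ^ 2) +
      (2 * Y * (α t * z t) + 2 * Z * (β t * y t + g t))) := by ring
    rw [this]
    refine mul_nonpos_of_nonneg_of_nonpos (exp_pos _).le ?_
    nlinarith
  have h0 : N 0 = 0 := by simp [N, min_eq_right hy0, min_eq_right hz0]
  have h1 : N t ≤ 0 := h0 ▸ hanti (mem_Ici.2 le_rfl) ht ht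
  have h2 : (min (y t) 0) ^ 2 + (min (z t) 0) ^ 2 ≤ 0 := by
    by_contra hc
    push Not at hc
    have : 0 < N t := mul_pos (exp_pos _) hc
    linarith
  have h3 : min (y t) 0 = 0 := by nlinarith [sq_nonneg (min (y t) 0), sq_nonneg (min (z t) 0)]
  have h4 : min (z t) 0 = 0 := by nlinarith [sq_nonneg (min (y t) 0), sq_nonneg (min (z t) 0)]
  exact ⟨min_eq_right_iff.1 h3, min_eq_right_iff.1 h4⟩

lemma le_of_hasDerivAt_nonneg {f f' : ℝ → ℝ} (hf : ∀ t, HasDerivAt f (f' t) t)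
    (h : ∀ t, 0 < t → 0 ≤ f' t) (t : ℝ) (ht : 0 ≤ t) : f 0 ≤ f t := by
  have : MonotoneOn f (Ici 0) := by
    refine monotoneOn_of_deriv_nonneg (convex_Ici 0)
      (fun t _ => (hf t).continuousAt.continuousWithinAt)
      (fun t _ => (hf t).differentiableAt.differentiableWithinAt) ?_
    intro t ht
    rw [interior_Ici] at ht
    rw [(hf t).deriv]
    exact h t ht
  exact this (mem_Ici.2 le_rfl) ht ht

lemma sys_pos {α β y z : ℝ → ℝ} {K : ℝ} (hα0 : ∀ t, 0 ≤ α t) (hβ0 : ∀ t, 0 ≤ β t)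
    (hαK : ∀ t, |α t| ≤ K) (hβK : ∀ t, |β t| ≤ K) (h : Sys α β y z)
    (hy0 : 0 ≤ y 0) (hz0 : 0 ≤ z 0) (t : ℝ) (ht : 0 ≤ t) : 0 ≤ y t ∧ 0 ≤ z t :=
  pos_lemma (g := fun _ => 0) hα0 hβ0 hαK hβK (fun _ _ => le_rfl) h.1
    (fun t => by simpa using h.2 t) hy0 hz0 t ht

lemma sys_first {α β y z : ℝ → ℝ} {K A B : ℝ} (hA : 0 < A) (hB : 0 < B)
    (hαA : ∀ t, A ≤ α t) (hβB : ∀ t, B ≤ β t)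
    (hαK : ∀ t, |α t| ≤ K) (hβK : ∀ t, |β t| ≤ K) (h : Sys α β y z)
    (hy0 : y 0 = 1) (hz0 : z 0 = 0) (t : ℝ) (ht : 0 ≤ t) :
    1 + A * B * t ^ 2 / 2 ≤ y t ∧ B * t ≤ z t := by
  have hα0 : ∀ t, 0 ≤ α t := fun t => hA.le.trans (hαA t)
  have hβ0 : ∀ t, 0 ≤ β t := fun t => hB.le.trans (hβB t)
  have hp := sys_pos hα0 hβ0 hαK hβK h (by rw [hy0]; norm_num) (by rw [hz0])
  have h1 : ∀ t, 0 ≤ t → 1 ≤ y t := fun t ht => hy0 ▸ le_of_hasDerivAt_nonneg h.1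
    (fun s hs => mul_nonneg (hα0 s) (hp s hs.le).2) t ht
  have h2 : ∀ t, 0 ≤ t → B * t ≤ z t := by
    intro t ht
    have := le_of_hasDerivAt_nonneg (f := fun t => z t - B * t) (f' := fun t => β t * y t - B)
      (fun s => ((h.2 s).sub ((hasDerivAt_id s).const_mul B)).congr_deriv (by simp))
      (fun s hs => by
        have := mul_le_mul (hβB s) (h1 s hs.le) zero_le_one (hβ0 s)
        linarith) t ht
    simp only [hz0] at this
    linarith
  refine ⟨?_, h2 t ht⟩
  have := le_of_hasDerivAt_nonneg (f := fun t => y t - A * B / 2 * t ^ 2)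
      (f' := fun t => α t * z t - A * B / 2 * (2 * t))
      (fun s => ((h.1 s).sub ((hasDerivAt_pow 2 s).const_mul (A * B / 2))).congr_deriv (by simp))
      (fun s hs => by
        have := mul_le_mul (hαA s) (h2 s hs.le) (by positivity) (hα0 s)
        linarith) t ht
  simp only [hy0] at this
  linarith

lemma sys_second {α β y z : ℝ → ℝ} {K : ℝ} (hα0 : ∀ t, 0 ≤ α t) (hβ0 : ∀ t, 0 ≤ β t)
    (hαK : ∀ t, |α t| ≤ K) (hβK : ∀ t, |β t| ≤ K) (h : Sys α β y z)
    (hy0 : y 0 = 0) (hz0 : z 0 = 1) (t : ℝ) (ht : 0 ≤ t) : 1 ≤ z t := by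
  have hp := sys_pos hα0 hβ0 hαK hβK h (by rw [hy0]) (by rw [hz0]; norm_num)
  exact hz0 ▸ le_of_hasDerivAt_nonneg h.2
    (fun s hs => mul_nonneg (hβ0 s) (hp s hs.le).1) t ht

lemma sys_mono {α β β' y z y' z' : ℝ → ℝ} {K K' : ℝ} (hα0 : ∀ t, 0 ≤ α t) (hβ0 : ∀ t, 0 ≤ β t)
    (hαK : ∀ t, |α t| ≤ K) (hβK : ∀ t, |β t| ≤ K)
    (hαK' : ∀ t, |α t| ≤ K') (hβK' : ∀ t, |β' t| ≤ K')
    (hββ : ∀ t, β t ≤ β' t) (h : Sys α β y z) (h' : Sys α β' y' z')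
    (hy : y 0 = y' 0) (hz : z 0 = z' 0) (hy0 : 0 ≤ y 0) (hz0 : 0 ≤ z 0) (t : ℝ) (ht : 0 ≤ t) :
    y t ≤ y' t ∧ z t ≤ z' t := by
  have hp := sys_pos hα0 hβ0 hαK hβK h hy0 hz0
  have := pos_lemma (α := α) (β := β') (y := fun t => y' t - y t) (z := fun t => z' t - z t)
    (g := fun t => (β' t - β t) * y t) hα0 (fun t => (hβ0 t).trans (hββ t)) hαK' hβK'
    (fun t ht => mul_nonneg (sub_nonneg.2 (hββ t)) (hp t ht).1)
    (fun t => ((h'.1 t).sub (h.1 t)).congr_deriv (by ring))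
    (fun t => ((h'.2 t).sub (h.2 t)).congr_deriv (by ring)) (by simp [hy]) (by simp [hz]) t ht
  constructor <;> linarith [this.1, this.2]

lemma const_of_hasDerivAt_zero {f : ℝ → ℝ} (hf : ∀ t, HasDerivAt f 0 t) (s t : ℝ) : f s = f t :=
  is_const_of_deriv_eq_zero (fun t => (hf t).differentiableAt) (fun t => (hf t).deriv) s t

lemma sys_wronsk {α β y z y' z' : ℝ → ℝ} (h : Sys α β y z) (h' : Sys α β y' z') (s t : ℝ) :
    y s * z' s - z s * y' s = y t * z' t - z t * y' t := by
  refine const_of_hasDerivAt_zero (f := fun t => y t * z' t - z t * y' t) (fun t => ?_) s t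
  exact (((h.1 t).mul (h'.2 t)).sub ((h.2 t).mul (h'.1 t))).congr_deriv (by ring)

lemma sys_expand {α β y1 z1 y2 z2 y z : ℝ → ℝ} (h1 : Sys α β y1 z1) (h2 : Sys α β y2 z2)
    (h : Sys α β y z) (W : ℝ) (hW : y1 0 * z2 0 - z1 0 * y2 0 = W) (t : ℝ) :
    W * y t = (y 0 * z2 0 - z 0 * y2 0) * y1 t + (y1 0 * z 0 - z1 0 * y 0) * y2 t ∧
    W * z t = (y 0 * z2 0 - z 0 * y2 0) * z1 t + (y1 0 * z 0 - z1 0 * y 0) * z2 t := by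
  rw [← hW, sys_wronsk h1 h2 0 t, sys_wronsk h h2 0 t, sys_wronsk h1 h 0 t]
  constructor <;> ring

lemma sys_shift {α β y z : ℝ → ℝ} {T : ℝ} (hα : Periodic α T) (hβ : Periodic β T)
    (h : Sys α β y z) : Sys α β (fun t => y (t + T)) (fun t => z (t + T)) :=
  ⟨fun t => by simpa [hα t] using (h.1 (t + T)).comp_add_const t T,
    fun t => by simpa [hβ t] using (h.2 (t + T)).comp_add_const t T⟩

lemma sys_comb {α β y z y' z' : ℝ → ℝ} (h : Sys α β y z) (h' : Sys α β y' z') (c d : ℝ) :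
    Sys α β (fun t => c * y t + d * y' t) (fun t => c * z t + d * z' t) :=
  ⟨fun t => (((h.1 t).const_mul c).add ((h'.1 t).const_mul d)).congr_deriv (by ring),
    fun t => (((h.2 t).const_mul c).add ((h'.2 t).const_mul d)).congr_deriv (by ring)⟩

lemma sys_floquet {α β y1 z1 y2 z2 : ℝ → ℝ} {T σ : ℝ} (hα : Periodic α T) (hβ : Periodic β T)
    (h1 : Sys α β y1 z1) (h2 : Sys α β y2 z2)
    (hy1 : y1 0 = 1) (hz1 : z1 0 = 0) (hy2 : y2 0 = 0) (hz2 : z2 0 = 1) (hc : 0 < z1 T)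
    (hT : 0 < T) (hσ : 0 < σ) (htr : 2 * cosh (σ * T) = y1 T + z2 T) :
    ∃ yp zp ym zm, Sys α β yp zp ∧ Sys α β ym zm ∧ yp 0 * zm 0 - zp 0 * ym 0 ≠ 0 ∧
      (∀ t, yp (t + T) = exp (-(σ * T)) * yp t) ∧ (∀ t, ym (t + T) = exp (σ * T) * ym t) := by
  have hdet : y1 T * z2 T - z1 T * y2 T = 1 := by
    rw [← sys_wronsk h1 h2 0 T, hy1, hz1, hy2, hz2]; ring
  have e1 := fun t => (sys_expand h1 h2 (sys_shift hα hβ h1) 1 (by rw [hy1, hz1, hy2, hz2]; ring) t).1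
  have e2 := fun t => (sys_expand h1 h2 (sys_shift hα hβ h2) 1 (by rw [hy1, hz1, hy2, hz2]; ring) t).1
  simp only [hy1, hz1, hy2, hz2, zero_add] at e1 e2
  have key : ∀ μ : ℝ, μ ^ 2 - (y1 T + z2 T) * μ + 1 = 0 → ∀ t,
      (μ - z2 T) * y1 (t + T) + z1 T * y2 (t + T) = μ * ((μ - z2 T) * y1 t + z1 T * y2 t) := by
    intro μ hμ t
    have a1 := e1 t
    have a2 := e2 t
    linear_combination (μ - z2 T) * a1 + z1 T * a2 - y1 t * hμ - y1 t * hdet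
  have hpm : exp (σ * T) * exp (-(σ * T)) = 1 := by rw [← exp_add]; simp
  have hch : exp (σ * T) + exp (-(σ * T)) = y1 T + z2 T := by
    rw [← htr, cosh_eq]; ring
  refine ⟨_, _, _, _, sys_comb h1 h2 (exp (-(σ * T)) - z2 T) (z1 T),
    sys_comb h1 h2 (exp (σ * T) - z2 T) (z1 T), ?_, ?_, ?_⟩
  · simp only [hy1, hz1, hy2, hz2]
    have : exp (-(σ * T)) < exp (σ * T) := exp_lt_exp.2 (by nlinarith)
    have h3 : (exp (-(σ * T)) - exp (σ * T)) * z1 T ≠ 0 := mul_ne_zero (by linarith) hc.ne'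
    intro h4; apply h3; linear_combination h4
  · exact key _ (by rw [← hch]; linear_combination -hpm)
  · exact key _ (by rw [← hch]; linear_combination -hpm)

lemma sys_smooth {α β y z : ℝ → ℝ} (hα : ContDiff ℝ (⊤ : ℕ∞) α) (hβ : ContDiff ℝ (⊤ : ℕ∞) β)
    (h : Sys α β y z) : ContDiff ℝ (⊤ : ℕ∞) y ∧ ContDiff ℝ (⊤ : ℕ∞) z := by
  have key : ∀ n : ℕ, ContDiff ℝ n y ∧ ContDiff ℝ n z := by
    intro n
    induction n with
    | zero =>
      constructor
      · exact contDiff_zero.2 (continuous_iff_continuousAt.2 fun t => (h.1 t).continuousAt)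
      · exact contDiff_zero.2 (continuous_iff_continuousAt.2 fun t => (h.2 t).continuousAt)
    | succ n ih =>
      have hα' : ContDiff ℝ n α := hα.of_le (by exact_mod_cast le_top)
      have hβ' : ContDiff ℝ n β := hβ.of_le (by exact_mod_cast le_top)
      have d1 : deriv y = fun t => α t * z t := funext fun t => (h.1 t).deriv
      have d2 : deriv z = fun t => β t * y t := funext fun t => (h.2 t).deriv
      push_cast
      rw [contDiff_succ_iff_deriv, contDiff_succ_iff_deriv, d1, d2]
      exact ⟨⟨fun t => (h.1 t).differentiableAt, by simp, hα'.mul ih.2⟩,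
        ⟨fun t => (h.2 t).differentiableAt, by simp, hβ'.mul ih.1⟩⟩
  exact ⟨contDiff_infty.2 fun n => (key n).1, contDiff_infty.2 fun n => (key n).2⟩

lemma periodic_deriv {f : ℝ → ℝ} {T : ℝ} (h : Periodic f T) : Periodic (deriv f) T := by
  intro t
  rw [← deriv_comp_add_const]
  congr 1
  exact funext h

lemma periodic_bdd {f : ℝ → ℝ} {T : ℝ} (hT : 0 < T) (h : Periodic f T) (hf : Continuous f) :
    ∃ K, ∀ t, |f t| ≤ K := by
  obtain ⟨K, hK⟩ := (h.isBounded_of_continuous hT.ne' hf).exists_norm_le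
  exact ⟨K, fun t => hK _ (mem_range_self t)⟩

lemma periodic_min {f : ℝ → ℝ} {T : ℝ} (hT : 0 < T) (h : Periodic f T) (hf : Continuous f) :
    ∃ t₀, ∀ t, f t₀ ≤ f t := by
  obtain ⟨x, ⟨t₀, rfl⟩, hx⟩ := (h.compact_of_continuous hT.ne' hf).exists_isLeast (range_nonempty f)
  exact ⟨t₀, fun t => hx (mem_range_self t)⟩

/-- From a basis of solutions of the first order system to a basis of the kernel. -/
lemma hill_basis {φ Q : ℝ → ℝ} {T σ : ℝ} (hφ : ContDiff ℝ (⊤ : ℕ∞) φ)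
    (hQ : ContDiff ℝ (⊤ : ℕ∞) Q) (pφ : Periodic φ T) (hpos : ∀ t, 0 < φ t)
    {yp zp ym zm : ℝ → ℝ}
    (hp : Sys (fun t => (φ t ^ 2)⁻¹) (fun t => φ t * (Q t * φ t - deriv (deriv φ) t)) yp zp)
    (hm : Sys (fun t => (φ t ^ 2)⁻¹) (fun t => φ t * (Q t * φ t - deriv (deriv φ) t)) ym zm)
    (hW : yp 0 * zm 0 - zp 0 * ym 0 ≠ 0)
    (mp : ∀ t, yp (t + T) = exp (-(σ * T)) * yp t) (mm : ∀ t, ym (t + T) = exp (σ * T) * ym t) :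
    ∃ q₁ q₂ : ℝ → ℝ, ContDiff ℝ (⊤ : ℕ∞) q₁ ∧ ContDiff ℝ (⊤ : ℕ∞) q₂ ∧
      Periodic q₁ T ∧ Periodic q₂ T ∧
      KerBasis (fun h t => -dtt h t + Q t * h t)
        (fun t => exp (-σ * t) * q₁ t) (fun t => exp (σ * t) * q₂ t) := by
  have hφ1 : ContDiff ℝ (⊤ : ℕ∞) (deriv φ) := (contDiff_infty_iff_deriv.1 hφ).2
  have hφ2 : ContDiff ℝ (⊤ : ℕ∞) (deriv (deriv φ)) := (contDiff_infty_iff_deriv.1 hφ1).2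
  have dφ : ∀ t, HasDerivAt φ (deriv φ t) t := fun t =>
    ((contDiff_infty_iff_deriv.1 hφ).1 t).hasDerivAt
  have dφ1 : ∀ t, HasDerivAt (deriv φ) (deriv (deriv φ) t) t := fun t =>
    ((contDiff_infty_iff_deriv.1 hφ1).1 t).hasDerivAt
  have sα : ContDiff ℝ (⊤ : ℕ∞) (fun t => (φ t ^ 2)⁻¹) :=
    (hφ.pow 2).inv (fun t => (pow_pos (hpos t) 2).ne')
  have sβ : ContDiff ℝ (⊤ : ℕ∞) (fun t => φ t * (Q t * φ t - deriv (deriv φ) t)) :=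
    hφ.mul ((hQ.mul hφ).sub hφ2)
  have syp := (sys_smooth sα sβ hp).1
  have sym := (sys_smooth sα sβ hm).1
  -- solutions of the system give solutions of the equation
  have sol : ∀ y z, Sys (fun t => (φ t ^ 2)⁻¹)
      (fun t => φ t * (Q t * φ t - deriv (deriv φ) t)) y z →
      ∀ t, -dtt (fun t => φ t * y t) t + Q t * (φ t * y t) = 0 := by
    intro y z h t
    have d1 : deriv (fun t => φ t * y t) = fun t => deriv φ t * y t + z t * (φ t)⁻¹ := by
      funext s
      refine ((dφ s).mul (h.1 s)).deriv.trans ?_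
      have := (hpos s).ne'
      field_simp
    have d2 : HasDerivAt (fun t => deriv φ t * y t + z t * (φ t)⁻¹) _ t :=
      ((dφ1 t).mul (h.1 t)).add ((h.2 t).mul ((dφ t).inv (hpos t).ne'))
    rw [dtt, d1, d2.deriv]
    have := (hpos t).ne'
    field_simp
    ring
  have conv : ∀ h : ℝ → ℝ, ContDiff ℝ 2 h → (∀ t, -dtt h t + Q t * h t = 0) →
      Sys (fun t => (φ t ^ 2)⁻¹) (fun t => φ t * (Q t * φ t - deriv (deriv φ) t))
        (fun t => h t * (φ t)⁻¹) (fun t => deriv h t * φ t - h t * deriv φ t) := by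
    intro h hh he
    have hh' : ContDiff ℝ (1 + 1) h := by norm_num; exact hh
    have c1 := contDiff_succ_iff_deriv.1 hh'
    have dh : ∀ t, HasDerivAt h (deriv h t) t := fun t => (c1.1 t).hasDerivAt
    have dh1 : ∀ t, HasDerivAt (deriv h) (Q t * h t) t := fun t => by
      have := ((c1.2.2.differentiable one_ne_zero) t).hasDerivAt
      refine this.congr_deriv ?_
      have h3 := he t
      rw [dtt] at h3
      linarith
    refine ⟨fun t => ?_, fun t => ?_⟩
    · refine ((dh t).mul ((dφ t).inv (hpos t).ne')).congr_deriv ?_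
      have := (hpos t).ne'
      simp only [Pi.inv_apply]
      field_simp
      ring
    · refine (((dh1 t).mul (dφ t)).sub ((dh t).mul (dφ1 t))).congr_deriv ?_
      have := (hpos t).ne'
      field_simp
      ring
  have ep : (fun t => exp (-σ * t) * (exp (σ * t) * (φ t * yp t))) = fun t => φ t * yp t := by
    funext t
    rw [← mul_assoc, ← exp_add]; simp
  have em : (fun t => exp (σ * t) * (exp (-σ * t) * (φ t * ym t))) = fun t => φ t * ym t := by
    funext t
    rw [← mul_assoc, ← exp_add]; simp
  have sexp : ∀ c : ℝ, ContDiff ℝ (⊤ : ℕ∞) (fun t : ℝ => exp (c * t)) := fun c =>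
    (contDiff_const.mul contDiff_id).exp
  have expansion := fun (h : ℝ → ℝ) (hh : ContDiff ℝ 2 h) (he : ∀ t, -dtt h t + Q t * h t = 0) t =>
    (sys_expand hp hm (conv h hh he) _ rfl t).1
  refine ⟨fun t => exp (σ * t) * (φ t * yp t), fun t => exp (-σ * t) * (φ t * ym t),
    (sexp _).mul (hφ.mul syp), (sexp _).mul (hφ.mul sym), ?_, ?_, ?_⟩
  · intro t
    have : exp (σ * (t + T)) * exp (-(σ * T)) = exp (σ * t) := by rw [← exp_add]; congr 1; ring
    simp only [pφ t, mp t, ← this]; ring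
  · intro t
    have : exp (-σ * (t + T)) * exp (σ * T) = exp (-σ * t) := by rw [← exp_add]; congr 1; ring
    simp only [pφ t, mm t, ← this]; ring
  · rw [ep, em]
    refine ⟨by exact_mod_cast contDiff_infty.1 (hφ.mul syp) 2,
      by exact_mod_cast contDiff_infty.1 (hφ.mul sym) 2, sol _ _ hp, sol _ _ hm, ?_, ?_⟩
    · rw [LinearIndependent.pair_iff]
      intro s r hsr
      have h0 : ∀ t, s * yp t + r * ym t = 0 := by
        intro t
        have := congrFun hsr t
        simp only [Pi.add_apply, Pi.smul_apply, smul_eq_mul, Pi.zero_apply] at this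
        have h2 : φ t * (s * yp t + r * ym t) = 0 := by linear_combination this
        exact (mul_eq_zero.1 h2).resolve_left (hpos t).ne'
      have h1 : s * zp 0 + r * zm 0 = 0 := by
        have d := (sys_comb hp hm s r).1 0
        have d' : HasDerivAt (fun t => s * yp t + r * ym t) 0 0 := by
          simp only [h0]; exact hasDerivAt_const _ _
        have := d.unique d'
        exact (mul_eq_zero.1 this).resolve_left (inv_ne_zero (pow_pos (hpos 0) 2).ne')
      have h00 := h0 0
      constructor
      · refine (mul_eq_zero.1 (?_ : s * (yp 0 * zm 0 - zp 0 * ym 0) = 0)).resolve_right hW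
        linear_combination zm 0 * h00 - ym 0 * h1
      · refine (mul_eq_zero.1 (?_ : r * (yp 0 * zm 0 - zp 0 * ym 0) = 0)).resolve_right hW
        linear_combination -zp 0 * h00 + yp 0 * h1
    · intro h hh he
      set W := yp 0 * zm 0 - zp 0 * ym 0
      have ex := expansion h hh he
      set a := (h 0 * (φ 0)⁻¹ * zm 0 - (deriv h 0 * φ 0 - h 0 * deriv φ 0) * ym 0)
      set b := (yp 0 * (deriv h 0 * φ 0 - h 0 * deriv φ 0) - zp 0 * (h 0 * (φ 0)⁻¹))
      refine ⟨a / W, b / W, fun t => ?_⟩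
      have e := ex t
      have := (hpos t).ne'
      field_simp
      field_simp at e
      linear_combination e

/-- Floquet theory of Hill's equation below the spectrum, as a function of the spectral
parameter. -/
lemma hill {φ Q : ℝ → ℝ} {T : ℝ} (hT : 0 < T) (hφ : ContDiff ℝ (⊤ : ℕ∞) φ)
    (hQ : ContDiff ℝ (⊤ : ℕ∞) Q) (pφ : Periodic φ T) (pQ : Periodic Q T) (hpos : ∀ t, 0 < φ t)
    (hsup : ∀ t, deriv (deriv φ) t < Q t * φ t) :
    ∃ σ : ℝ → ℝ, (∀ r, 0 ≤ r → 0 < σ r) ∧ (∀ r s, 0 ≤ r → r ≤ s → σ r ≤ σ s) ∧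
      Tendsto σ atTop atTop ∧ ∀ r, 0 ≤ r →
      ∃ q₁ q₂ : ℝ → ℝ, ContDiff ℝ (⊤ : ℕ∞) q₁ ∧ ContDiff ℝ (⊤ : ℕ∞) q₂ ∧
      Periodic q₁ T ∧ Periodic q₂ T ∧
      KerBasis (fun h t => -dtt h t + (r + Q t) * h t)
        (fun t => exp (-(σ r) * t) * q₁ t) (fun t => exp (σ r * t) * q₂ t) := by
  have hφ1 : ContDiff ℝ (⊤ : ℕ∞) (deriv φ) := (contDiff_infty_iff_deriv.1 hφ).2
  have hφ2 : ContDiff ℝ (⊤ : ℕ∞) (deriv (deriv φ)) := (contDiff_infty_iff_deriv.1 hφ1).2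
  have pφ2 : Periodic (deriv (deriv φ)) T := periodic_deriv (periodic_deriv pφ)
  let α : ℝ → ℝ := fun t => (φ t ^ 2)⁻¹
  let β : ℝ → ℝ → ℝ := fun r t => φ t * ((r + Q t) * φ t - deriv (deriv φ) t)
  have cα : Continuous α :=
    ((hφ.pow 2).inv (fun t => (pow_pos (hpos t) 2).ne')).continuous
  have cβ : ∀ r, Continuous (β r) := fun r =>
    (hφ.mul (((contDiff_const.add hQ).mul hφ).sub hφ2)).continuous
  have pα : Periodic α T := fun t => by simp only [α, pφ t]
  have pβ : ∀ r, Periodic (β r) T := fun r t => by simp only [β, pφ t, pQ t, pφ2 t]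
  obtain ⟨K1, hK1⟩ := periodic_bdd hT pα cα
  choose K2 hK2 using fun r => periodic_bdd hT (pβ r) (cβ r)
  let K : ℝ → ℝ := fun r => max K1 (K2 r)
  have hαK : ∀ r t, |α t| ≤ K r := fun r t => (hK1 t).trans (le_max_left _ _)
  have hβK : ∀ r t, |β r t| ≤ K r := fun r t => (hK2 r t).trans (le_max_right _ _)
  obtain ⟨t1, ht1⟩ := periodic_min hT pα cα
  obtain ⟨t2, ht2⟩ := periodic_min hT (pβ 0) (cβ 0)
  obtain ⟨t3, ht3⟩ := periodic_min (f := fun t => φ t ^ 2) hT (fun t => by simp only [pφ t]) (hφ.continuous.pow 2)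
  have ht3' : ∀ t, φ t3 ^ 2 ≤ φ t ^ 2 := ht3
  have hA : 0 < α t1 := inv_pos.2 (pow_pos (hpos _) 2)
  have hB : 0 < β 0 t2 := mul_pos (hpos _) (by have := hsup t2; linarith)
  have hm : 0 < φ t3 ^ 2 := pow_pos (hpos _) 2
  set A := α t1
  set B := β 0 t2
  set m := φ t3 ^ 2
  have hβB : ∀ r, 0 ≤ r → ∀ t, B + r * m ≤ β r t := by
    intro r hr t
    have h1 := ht2 t
    have h2 := mul_le_mul_of_nonneg_left (ht3' t) hr
    have h3 : β r t = β 0 t + r * φ t ^ 2 := by simp only [β]; ring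
    rw [h3]; exact add_le_add h1 h2
  have hBr : ∀ r, 0 ≤ r → 0 < B + r * m := fun r hr => by positivity
  have hα0 : ∀ t, 0 ≤ α t := fun t => hA.le.trans (ht1 t)
  have hβ0 : ∀ r, 0 ≤ r → ∀ t, 0 ≤ β r t := fun r hr t => (hBr r hr).le.trans (hβB r hr t)
  have hββ : ∀ r s, r ≤ s → ∀ t, β r t ≤ β s t := by
    intro r s hrs t
    have : β s t - β r t = (s - r) * φ t ^ 2 := by simp only [β]; ring
    have h2 : 0 ≤ (s - r) * φ t ^ 2 := mul_nonneg (by linarith) (sq_nonneg _)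
    linarith
  choose y1 z1 h1 hy1 hz1 using fun r => exists_sys α (β r) cα (cβ r) (hαK r) (hβK r) 1 0
  choose y2 z2 h2 hy2 hz2 using fun r => exists_sys α (β r) cα (cβ r) (hαK r) (hβK r) 0 1
  let Δ : ℝ → ℝ := fun r => y1 r T + z2 r T
  have first := fun r (hr : 0 ≤ r) =>
    sys_first hA (hBr r hr) ht1 (hβB r hr) (hαK r) (hβK r) (h1 r) (hy1 r) (hz1 r) T hT.le
  have hΔ : ∀ r, 0 ≤ r → 2 + A * (B + r * m) * T ^ 2 / 2 ≤ Δ r := by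
    intro r hr
    have a1 := (first r hr).1
    have a2 := sys_second hα0 (hβ0 r hr) (hαK r) (hβK r) (h2 r) (hy2 r) (hz2 r) T hT.le
    simp only [Δ]; linarith
  have hΔ2 : ∀ r, 0 ≤ r → 1 < Δ r / 2 := by
    intro r hr
    have a1 := hΔ r hr
    have a2 := hBr r hr
    have : 0 < A * (B + r * m) * T ^ 2 / 2 := by positivity
    linarith
  have hΔm : ∀ r s, 0 ≤ r → r ≤ s → Δ r ≤ Δ s := by
    intro r s hr hrs
    have a1 := (sys_mono hα0 (hβ0 r hr) (hαK r) (hβK r) (hαK s) (hβK s) (hββ r s hrs) (h1 r) (h1 s)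
      (by rw [hy1, hy1]) (by rw [hz1, hz1]) (by rw [hy1]; norm_num) (by rw [hz1]) T hT.le).1
    have a2 := (sys_mono hα0 (hβ0 r hr) (hαK r) (hβK r) (hαK s) (hβK s) (hββ r s hrs) (h2 r) (h2 s)
      (by rw [hy2, hy2]) (by rw [hz2, hz2]) (by rw [hy2]) (by rw [hz2]; norm_num) T hT.le).2
    exact add_le_add a1 a2
  refine ⟨fun r => arcosh (Δ r / 2) / T, ?_, ?_, ?_, ?_⟩
  · intro r hr
    exact div_pos (arcosh_pos (hΔ2 r hr)) hT
  · intro r s hr hrs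
    have a1 := hΔ2 r hr
    have a2 := hΔ2 s (hr.trans hrs)
    have a3 := hΔm r s hr hrs
    have := (arcosh_le_arcosh (by linarith : 0 < Δ r / 2) (by linarith : 0 < Δ s / 2)).2
      (by linarith)
    show arcosh (Δ r / 2) / T ≤ arcosh (Δ s / 2) / T
    gcongr
  · have hlin : Tendsto (fun r : ℝ => A * m * T ^ 2 / 4 * r) atTop atTop :=
      tendsto_id.const_mul_atTop (by positivity)
    have hlog := (tendsto_log_atTop.comp hlin).atTop_div_const hT
    refine tendsto_atTop_mono' _ ?_ hlog
    filter_upwards [eventually_gt_atTop 0] with r hr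
    show log (A * m * T ^ 2 / 4 * r) / T ≤ arcosh (Δ r / 2) / T
    have a1 := hΔ2 r hr.le
    have a2 : A * m * T ^ 2 / 4 * r ≤ Δ r / 2 := by
      have := hΔ r hr.le
      have h3 : 0 < A * B * T ^ 2 := by positivity
      nlinarith
    have a3 : Δ r / 2 ≤ exp (arcosh (Δ r / 2)) := by
      rw [exp_arcosh a1.le]
      linarith [Real.sqrt_nonneg ((Δ r / 2) ^ 2 - 1)]
    have a4 : log (A * m * T ^ 2 / 4 * r) ≤ arcosh (Δ r / 2) := by
      rw [log_le_iff_le_exp (by positivity)]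
      exact a2.trans a3
    gcongr
  · intro r hr
    have hσ : 0 < arcosh (Δ r / 2) / T := div_pos (arcosh_pos (hΔ2 r hr)) hT
    have htr : 2 * cosh (arcosh (Δ r / 2) / T * T) = y1 r T + z2 r T := by
      rw [div_mul_cancel₀ _ hT.ne', cosh_arcosh (hΔ2 r hr).le]
      simp only [Δ]; ring
    have hc : 0 < z1 r T := lt_of_lt_of_le (mul_pos (hBr r hr) hT) (first r hr).2
    obtain ⟨yp, zp, ym, zm, hp, hm', hW, mp, mm⟩ := sys_floquet pα (pβ r) (h1 r) (h2 r) (hy1 r)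
      (hz1 r) (hy2 r) (hz2 r) hc hT hσ htr
    exact hill_basis (Q := fun t => r + Q t) hφ (contDiff_const.add hQ) pφ hpos hp hm' hW mp mm

lemma cumHarm_lower (n d : ℕ) (hn : 3 ≤ n) : d + 1 ≤ cumHarm n d := by
  have h1 : Nat.choose (n - 1 + d) (n - 1) = Nat.choose (n - 1 + d) d := Nat.choose_symm_add
  have h2 : Nat.choose (d + 1) d ≤ Nat.choose (n - 1 + d) d := Nat.choose_le_choose d (by omega)
  rw [Nat.choose_succ_self_right] at h2
  unfold cumHarm
  omega

lemma cumHarm_mono (n : ℕ) : Monotone (cumHarm n) := by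
  intro d e h
  unfold cumHarm
  exact add_le_add (Nat.choose_le_choose _ (by omega)) (Nat.choose_le_choose _ (by omega))

lemma sphDeg_mem (n i : ℕ) (hn : 3 ≤ n) : i < cumHarm n (sphDeg n i) :=
  Nat.sInf_mem (s := {d | i < cumHarm n d}) ⟨i, cumHarm_lower n i hn⟩

lemma sphDeg_mono (n : ℕ) (hn : 3 ≤ n) : Monotone (sphDeg n) := by
  intro i j h
  exact Nat.sInf_le (lt_of_le_of_lt h (sphDeg_mem n j hn))

lemma sphDeg_pos (n i : ℕ) (hn : 3 ≤ n) (hi : 1 ≤ i) : 1 ≤ sphDeg n i := by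
  by_contra hc
  have h0 : sphDeg n i = 0 := by omega
  have := sphDeg_mem n i hn
  rw [h0] at this
  have h1 : cumHarm n 0 = 1 := by
    unfold cumHarm
    rw [Nat.choose_eq_zero_of_lt (show n - 2 + 0 < n - 1 by omega)]
    simp
  omega

lemma sphDeg_tendsto (n : ℕ) (hn : 3 ≤ n) : Tendsto (sphDeg n) atTop atTop := by
  refine tendsto_atTop.2 fun D => ?_
  filter_upwards [eventually_ge_atTop (cumHarm n D)] with i hi
  by_contra hc
  have h1 := sphDeg_mem n i hn
  have h2 := cumHarm_mono n (show sphDeg n i ≤ D by omega)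
  omega

lemma sphEval_ge (n i : ℕ) (hn : 3 ≤ n) (hi : 1 ≤ i) : (n : ℝ) - 1 ≤ sphEval n i := by
  have h1 : (1 : ℝ) ≤ sphDeg n i := by exact_mod_cast sphDeg_pos n i hn hi
  have h2 : (3 : ℝ) ≤ n := by exact_mod_cast hn
  unfold sphEval
  nlinarith

lemma sphEval_mono (n : ℕ) (hn : 3 ≤ n) : Monotone (sphEval n) := by
  intro i j h
  have h1 : (sphDeg n i : ℝ) ≤ sphDeg n j := by exact_mod_cast sphDeg_mono n hn h
  have h2 : (3 : ℝ) ≤ n := by exact_mod_cast hn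
  have h3 : (0 : ℝ) ≤ sphDeg n i := by positivity
  unfold sphEval
  nlinarith

lemma sphEval_tendsto (n : ℕ) (hn : 3 ≤ n) : Tendsto (sphEval n) atTop atTop := by
  have h2 : (3 : ℝ) ≤ n := by exact_mod_cast hn
  refine tendsto_atTop_mono (fun i => ?_) (tendsto_natCast_atTop_atTop.comp (sphDeg_tendsto n hn))
  have h3 : (0 : ℝ) ≤ sphDeg n i := by positivity
  simp only [Function.comp, sphEval]
  nlinarith

lemma param_ineq {n a b p : ℝ} (hn : 3 ≤ n) (ha0 : 0 ≤ a) (ha : a < (n - 2) / 2) (hab : a ≤ b)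
    (hb : b < a + 1) (hp : p = 2 * n / (n - 2 + 2 * (b - a))) :
    2 < p ∧ (p / 2) ^ 2 * ((n - 2 * a - 2) ^ 2 / 4) ≤ n - 1 + (n - 2 * a - 2) ^ 2 / 4 := by
  set d := n - 2 + 2 * (b - a) with hd
  have hd0 : n - 2 ≤ d := by linarith
  have hdn : d < n := by linarith
  have hdpos : 0 < d := by linarith
  refine ⟨by rw [hp, lt_div_iff₀ hdpos]; linarith, ?_⟩
  have hs : p / 2 = n / d := by rw [hp]; ring
  rw [hs, div_pow, div_mul_eq_mul_div, div_le_iff₀ (by positivity)]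
  set κ := (n - 2 * a - 2) ^ 2 / 4 with hκ
  have hκd : κ ≤ d ^ 2 / 4 := by
    have : (n - 2 * a - 2) ^ 2 ≤ d ^ 2 := by
      apply pow_le_pow_left₀ <;> linarith
    rw [hκ]; linarith
  have h1 : n ^ 2 - d ^ 2 ≤ 4 * (n - 1) := by nlinarith
  have h2 : 0 ≤ n ^ 2 - d ^ 2 := by nlinarith
  have h3 : κ * (n ^ 2 - d ^ 2) ≤ d ^ 2 / 4 * (4 * (n - 1)) :=
    mul_le_mul hκd h1 h2 (by positivity)
  nlinarith

lemma min_second_deriv {f : ℝ → ℝ} (hf : Continuous f) {t₀ : ℝ} (h : ∀ t, f t₀ ≤ f t) :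
    deriv f t₀ = 0 ∧ 0 ≤ deriv (deriv f) t₀ := by
  have hmin : IsLocalMin f t₀ := Eventually.of_forall h
  have h0 := hmin.deriv_eq_zero
  refine ⟨h0, ?_⟩
  by_contra hc
  push Not at hc
  have hmax := isLocalMax_of_deriv_deriv_neg hc h0 hf.continuousAt
  have heq : f =ᶠ[nhds t₀] fun _ => f t₀ := by
    filter_upwards [hmax] with t ht
    exact le_antisymm ht (h t)
  have := heq.deriv.deriv_eq
  simp at this
  linarith

section Zeta

variable {ζ : ℝ → ℝ} {κ p T : ℝ}

lemma zeta_smooth (h2 : ContDiff ℝ 2 ζ) (hpos : ∀ t, 0 < ζ t)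
    (heq : ∀ t, deriv (deriv ζ) t = κ * ζ t - ζ t ^ (p - 1)) : ContDiff ℝ (⊤ : ℕ∞) ζ := by
  have hh' : ContDiff ℝ (1 + 1) ζ := by norm_num; exact h2
  have c1 := contDiff_succ_iff_deriv.1 hh'
  have d1 : Differentiable ℝ (deriv ζ) := c1.2.2.differentiable one_ne_zero
  have key : ∀ n : ℕ, ContDiff ℝ n ζ ∧ ContDiff ℝ n (deriv ζ) := by
    intro n
    induction n with
    | zero => exact ⟨contDiff_zero.2 c1.1.continuous, contDiff_zero.2 d1.continuous⟩
    | succ n ih =>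
      push_cast
      rw [contDiff_succ_iff_deriv, contDiff_succ_iff_deriv, funext heq]
      refine ⟨⟨c1.1, by simp, ih.2⟩, ⟨d1, by simp, ?_⟩⟩
      exact (contDiff_const.mul ih.1).sub (ih.1.rpow_const_of_ne fun t => (hpos t).ne')
  exact contDiff_infty.2 fun n => (key n).1

lemma zeta_energy (hp : 2 < p) (hT : 0 < T) (hper : Periodic ζ T)
    (hs : ContDiff ℝ (⊤ : ℕ∞) ζ) (hpos : ∀ t, 0 < ζ t)
    (heq : ∀ t, deriv (deriv ζ) t = κ * ζ t - ζ t ^ (p - 1)) (t : ℝ) :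
    deriv ζ t ^ 2 < κ * ζ t ^ 2 - 2 / p * (ζ t ^ (p - 2) * ζ t ^ 2) := by
  have hs1 := (contDiff_infty_iff_deriv.1 hs).2
  have d0 : ∀ t, HasDerivAt ζ (deriv ζ t) t := fun t =>
    ((contDiff_infty_iff_deriv.1 hs).1 t).hasDerivAt
  have d1 : ∀ t, HasDerivAt (deriv ζ) (deriv (deriv ζ) t) t := fun t =>
    ((contDiff_infty_iff_deriv.1 hs1).1 t).hasDerivAt
  have e : ∀ t, ζ t ^ (p - 2) * ζ t ^ 2 = ζ t ^ p := fun t => by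
    rw [← rpow_natCast, ← rpow_add (hpos t)]; congr 1; push_cast; ring
  have e1 : ∀ t, ζ t ^ (p - 1) * ζ t = ζ t ^ p := fun t => by
    rw [← rpow_add_one (hpos t).ne']; congr 1; ring
  rw [e]
  obtain ⟨t₀, h0⟩ := periodic_min hT hper hs.continuous
  obtain ⟨m1, m2⟩ := min_second_deriv hs.continuous h0
  have hc := const_of_hasDerivAt_zero
    (f := fun t => deriv ζ t ^ 2 - κ * ζ t ^ 2 + 2 / p * ζ t ^ p) (fun t => by
      refine ((((d1 t).pow 2).sub (((d0 t).pow 2).const_mul κ)).add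
        (((d0 t).rpow_const (p := p) (Or.inl (hpos t).ne')).const_mul (2 / p))).congr_deriv ?_
      rw [heq t]
      have : p ≠ 0 := by linarith
      field_simp
      ring) t t₀
  simp only [m1] at hc
  have h3 : ζ t₀ ^ p ≤ κ * ζ t₀ ^ 2 := by
    rw [heq] at m2
    have := mul_nonneg m2 (hpos t₀).le
    rw [sub_mul, e1] at this
    linarith
  have h4 : 0 < ζ t₀ ^ p := rpow_pos_of_pos (hpos _) _
  have h5 : 2 / p * ζ t₀ ^ p < ζ t₀ ^ p := by
    have : 2 / p < 1 := by rw [div_lt_one (by linarith)]; exact hp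
    nlinarith
  linarith

lemma zeta_super {N : ℝ} (hp : 2 < p) (hT : 0 < T) (hper : Periodic ζ T)
    (hs : ContDiff ℝ (⊤ : ℕ∞) ζ) (hpos : ∀ t, 0 < ζ t)
    (heq : ∀ t, deriv (deriv ζ) t = κ * ζ t - ζ t ^ (p - 1))
    (hN : (p / 2) ^ 2 * κ ≤ N + κ) (t : ℝ) :
    deriv (deriv (fun t => ζ t ^ (p / 2))) t <
      (N + κ - (p - 1) * ζ t ^ (p - 2)) * ζ t ^ (p / 2) := by
  have hs1 := (contDiff_infty_iff_deriv.1 hs).2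
  have d0 : ∀ t, HasDerivAt ζ (deriv ζ t) t := fun t =>
    ((contDiff_infty_iff_deriv.1 hs).1 t).hasDerivAt
  have d1 : ∀ t, HasDerivAt (deriv ζ) (deriv (deriv ζ) t) t := fun t =>
    ((contDiff_infty_iff_deriv.1 hs1).1 t).hasDerivAt
  have f1 : ∀ t, HasDerivAt (fun t => ζ t ^ (p / 2)) (p / 2 * ζ t ^ (p / 2) * deriv ζ t / ζ t) t := by
    intro t
    refine ((d0 t).rpow_const (p := p / 2) (Or.inl (hpos t).ne')).congr_deriv ?_
    rw [rpow_sub_one (hpos t).ne']; ring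
  have f1' : deriv (fun t => ζ t ^ (p / 2)) =
      fun t => p / 2 * ζ t ^ (p / 2) * deriv ζ t / ζ t := funext fun t => (f1 t).deriv
  have f2 := ((((f1 t).const_mul (p / 2)).mul (d1 t)).div (d0 t) (hpos t).ne').deriv
  rw [f1']
  refine lt_of_eq_of_lt f2 ?_
  have e1 : ζ t ^ (p - 1) = ζ t ^ (p - 2) * ζ t := by
    rw [← rpow_add_one (hpos t).ne']; congr 1; ring
  rw [heq t, e1]
  have en := zeta_energy hp hT hper hs hpos heq t
  set X := ζ t ^ (p - 2)
  set φ := ζ t ^ (p / 2) with hφ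
  have hφ0 : 0 < φ := rpow_pos_of_pos (hpos t) _
  have hz := hpos t
  simp only [Pi.mul_apply]
  set z := ζ t
  set z' := deriv ζ t
  have hid : ((p / 2 * (p / 2 * φ * z' / z) * z' + p / 2 * φ * (κ * z - X * z)) * z
      - p / 2 * φ * z' * z') / z ^ 2 =
      φ * (p / 2) * ((p / 2 - 1) * (z' ^ 2 / z ^ 2) + κ - X) := by
    field_simp
    ring
  have h1 : z' ^ 2 / z ^ 2 < κ - 2 / p * X := by
    rw [div_lt_iff₀ (by positivity)]
    linarith
  have h2 : (p / 2) * ((p / 2 - 1) * (z' ^ 2 / z ^ 2) + κ - X) < N + κ - (p - 1) * X := by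
    have h3 : (p / 2) * ((p / 2 - 1) * (z' ^ 2 / z ^ 2)) < (p / 2) * ((p / 2 - 1) * (κ - 2 / p * X)) := by
      have : 0 < p / 2 - 1 := by linarith
      have : 0 < p / 2 := by linarith
      gcongr
    have h4 : (p / 2) * ((p / 2 - 1) * (κ - 2 / p * X)) =
        (p / 2) ^ 2 * κ - p / 2 * κ - (p / 2 - 1) * X := by
      have : p ≠ 0 := by linarith
      field_simp
    nlinarith
  refine lt_of_eq_of_lt hid ?_
  have := mul_lt_mul_of_pos_left h2 hφ0
  nlinarith

end Zeta

/-- (Lemma B.5: kernels of `𝓛_i`, `i ≥ 1`, at a nonconstant periodic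
solution of the CKN Fowler equation.) -/
theorem statement_18 (n : ℕ) (hn : 3 ≤ n) (a b p : ℝ)
    (ha0 : 0 ≤ a) (ha : a < ((n : ℝ) - 2) / 2) (hab : a ≤ b) (hb : b < a + 1)
    (hp : p = 2 * (n : ℝ) / ((n : ℝ) - 2 + 2 * (b - a)))
    (ζ : ℝ → ℝ) (T : ℝ) (hζ : ZetaSol n a p ζ T)
    (hnc : ∃ t s : ℝ, ζ t ≠ ζ s) :
    ∃ σ : ℕ → ℝ, CKNExponents n a p ζ T σ := by
  obtain ⟨h2, hpos, hT, hper, heq⟩ := hζ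
  have hn' : (3 : ℝ) ≤ n := by exact_mod_cast hn
  obtain ⟨hp2, hN⟩ := param_ineq hn' ha0 ha hab hb hp
  have heq' : ∀ t, deriv (deriv ζ) t = ((n : ℝ) - 2 * a - 2) ^ 2 / 4 * ζ t - ζ t ^ (p - 1) := by
    intro t
    have := heq t
    rw [dtt] at this
    linarith
  have hs := zeta_smooth h2 hpos heq'
  obtain ⟨σ, s1, s2, s3, s4⟩ := hill (φ := fun t => ζ t ^ (p / 2))
    (Q := fun t => (n : ℝ) - 1 + ((n : ℝ) - 2 * a - 2) ^ 2 / 4 - (p - 1) * ζ t ^ (p - 2)) hT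
    (hs.rpow_const_of_ne fun t => (hpos t).ne')
    (contDiff_const.sub (contDiff_const.mul (hs.rpow_const_of_ne fun t => (hpos t).ne')))
    (fun t => by simp only [hper t]) (fun t => by simp only [hper t])
    (fun t => rpow_pos_of_pos (hpos t) _)
    (zeta_super hp2 hT hper hs hpos heq' hN)
  refine ⟨fun i => σ (sphEval n i - ((n : ℝ) - 1)), fun i hi => s1 _ ?_, fun i j hi hij => s2 _ _ ?_ ?_,
    s3.comp (tendsto_atTop_add_const_right _ _ (sphEval_tendsto n hn)), fun i hi => ?_⟩
  · linarith [sphEval_ge n i hn hi]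
  · linarith [sphEval_ge n i hn hi]
  · linarith [sphEval_mono n hn hij]
  · obtain ⟨q₁, q₂, c1, c2, p1, p2, hk⟩ := s4 (sphEval n i - ((n : ℝ) - 1))
      (by linarith [sphEval_ge n i hn hi])
    refine ⟨q₁, q₂, c1, c2, p1, p2, ?_⟩
    have hL : LopCKN n a p ζ (sphEval n i) = fun h t => -dtt h t + (sphEval n i - ((n : ℝ) - 1) +
        ((n : ℝ) - 1 + ((n : ℝ) - 2 * a - 2) ^ 2 / 4 - (p - 1) * ζ t ^ (p - 2))) * h t := by
      funext h t
      simp only [LopCKN]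
      ring
    rw [hL]
    exact hk
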